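/- arXiv:2006.02614 — 3 statements merged into one kernel-verified Lean document; each statement's English description precedes it below -/
import Mathlib

section
/- Let L : ℝ^D × ℝ^D → ℝ be twice continuously differentiable, with velocity Hessian M(q,v), antisymmetric matrix F(q,v), energy E(q,v) = ⟨v, ∂L/∂v⟩ − L, and Lagrangian two-form Ω_L(q,v) as defined. Then there exists a second-order solution of the energy equation at (q,v), i.e. a vector X = (v, Xv) with Ω_L(q,v)(X,Y) = dE(q,v)(Y) for all Y, if and only if the first-order constraint functions vanish at (q,v): ⟨z, ∇_q E(q,v) + F(q,v)·v⟩ = 0 for every z ∈ ker M(q,v). -/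
open Matrix

/-- Gradient of `L` in the velocity variables: `(∇_v L)_a = ∂L/∂v^a`. -/
noncomputable def gradV (D : ℕ) (L : (Fin D → ℝ) × (Fin D → ℝ) → ℝ)
    (u : (Fin D → ℝ) × (Fin D → ℝ)) : Fin D → ℝ :=
  fun a => fderiv ℝ L u (0, Pi.single a 1)

/-- Gradient of a phase-space function in the position variables. -/
noncomputable def gradQ (D : ℕ) (f : (Fin D → ℝ) × (Fin D → ℝ) → ℝ)
    (u : (Fin D → ℝ) × (Fin D → ℝ)) : Fin D → ℝ :=
  fun a => fderiv ℝ f u (Pi.single a 1, 0)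

/-- The fibre derivative (Legendre map) `FL(q,v) = (q, ∂L/∂v(q,v))`. -/
noncomputable def FL (D : ℕ) (L : (Fin D → ℝ) × (Fin D → ℝ) → ℝ) :
    (Fin D → ℝ) × (Fin D → ℝ) → (Fin D → ℝ) × (Fin D → ℝ) :=
  fun u => (u.1, gradV D L u)

/-- The velocity Hessian `M_{ab} = ∂²L/∂v^a∂v^b`. -/
noncomputable def hessV (D : ℕ) (L : (Fin D → ℝ) × (Fin D → ℝ) → ℝ)
    (u : (Fin D → ℝ) × (Fin D → ℝ)) : Matrix (Fin D) (Fin D) ℝ :=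
  Matrix.of fun a b =>
    fderiv ℝ (fun w => fderiv ℝ L w (0, Pi.single a 1)) u (0, Pi.single b 1)

/-- The antisymmetric matrix `F_{ab} = ∂²L/∂v^a∂q^b − ∂²L/∂v^b∂q^a`. -/
noncomputable def Fmat (D : ℕ) (L : (Fin D → ℝ) × (Fin D → ℝ) → ℝ)
    (u : (Fin D → ℝ) × (Fin D → ℝ)) : Matrix (Fin D) (Fin D) ℝ :=
  Matrix.of fun a b =>
    fderiv ℝ (fun w => fderiv ℝ L w (0, Pi.single a 1)) u (Pi.single b 1, 0)
      - fderiv ℝ (fun w => fderiv ℝ L w (0, Pi.single b 1)) u (Pi.single a 1, 0)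

/-- The energy `E(q,v) = ⟨v, ∂L/∂v⟩ − L(q,v)`. -/
noncomputable def energy (D : ℕ) (L : (Fin D → ℝ) × (Fin D → ℝ) → ℝ)
    (u : (Fin D → ℝ) × (Fin D → ℝ)) : ℝ :=
  u.2 ⬝ᵥ gradV D L u - L u

/-- The presymplectic Lagrangian two-form
`Ω((Xq,Xv),(Yq,Yv)) = Σ F_{ab} Xq^a Yq^b + Σ M_{ab}(Xq^a Yv^b − Yq^a Xv^b)`
on `ℝ^D × ℝ^D`. -/
def Omega (D : ℕ) (M F : Matrix (Fin D) (Fin D) ℝ)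
    (X Y : (Fin D → ℝ) × (Fin D → ℝ)) : ℝ :=
  X.1 ⬝ᵥ F.mulVec Y.1 + X.1 ⬝ᵥ M.mulVec Y.2 - Y.1 ⬝ᵥ M.mulVec X.2

/-- The canonical symplectic bilinear pairing `ω((a,b),(c,d)) = ⟨a,d⟩ − ⟨c,b⟩`. -/
def omegaCan (D : ℕ) (X Y : (Fin D → ℝ) × (Fin D → ℝ)) : ℝ :=
  X.1 ⬝ᵥ Y.2 - Y.1 ⬝ᵥ X.2

namespace Matrix

/-- Fredholm alternative for a symmetric matrix over a field: a vector orthogonal to the kernel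
lies in the range. -/
theorem IsSymm.exists_mulVec_eq_of_forall_dotProduct_eq_zero {n K : Type*} [Fintype n]
    [DecidableEq n] [Field K] {M : Matrix n n K} (hM : M.IsSymm) {w : n → K}
    (hw : ∀ z, M *ᵥ z = 0 → z ⬝ᵥ w = 0) : ∃ x, M *ᵥ x = w := by
  have hmem : dotProductEquiv K n w ∈ LinearMap.range M.mulVecLin.dualMap := by
    rw [LinearMap.range_dualMap_eq_dualAnnihilator_ker, Submodule.mem_dualAnnihilator]
    intro z hz
    have hwz : w ⬝ᵥ z = 0 := by
      rw [dotProduct_comm]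
      exact hw z (by simpa using hz)
    simpa using hwz
  obtain ⟨ψ, hψ⟩ := hmem
  obtain ⟨x, rfl⟩ := (dotProductEquiv K n).surjective ψ
  refine ⟨x, (dotProductEquiv K n).injective (LinearMap.ext fun z => ?_)⟩
  have hz : x ⬝ᵥ M *ᵥ z = w ⬝ᵥ z := by simpa using LinearMap.congr_fun hψ z
  change M *ᵥ x ⬝ᵥ z = w ⬝ᵥ z
  rw [← hz, dotProduct_mulVec, ← mulVec_transpose, hM.eq]

end Matrix

section

variable {D : ℕ} {L : (Fin D → ℝ) × (Fin D → ℝ) → ℝ}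

theorem differentiable_fderiv_apply (hL : ContDiff ℝ 2 L) (X : (Fin D → ℝ) × (Fin D → ℝ)) :
    Differentiable ℝ fun w => fderiv ℝ L w X :=
  ((hL.fderiv_right (m := 1) (by norm_num)).differentiable (by norm_num)).clm_apply
    (differentiable_const X)

theorem hessV_isSymm (hL : ContDiff ℝ 2 L) (u : (Fin D → ℝ) × (Fin D → ℝ)) :
    (hessV D L u).IsSymm := by
  have hd : DifferentiableAt ℝ (fderiv ℝ L) u :=
    (hL.fderiv_right (m := 1) (by norm_num)).differentiable (by norm_num) u
  have happ (X Y : (Fin D → ℝ) × (Fin D → ℝ)) :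
      fderiv ℝ (fun w => fderiv ℝ L w X) u Y = fderiv ℝ (fderiv ℝ L) u Y X := by
    rw [(hd.hasFDerivAt.clm_apply (hasFDerivAt_const X u)).fderiv]
    simp
  ext a b
  simp only [hessV, transpose_apply, of_apply, happ]
  exact hL.contDiffAt.isSymmSndFDerivAt (by simp) _ _

theorem Fmat_transpose (u : (Fin D → ℝ) × (Fin D → ℝ)) :
    (Fmat D L u)ᵀ = -Fmat D L u := by
  ext a b
  simp [Fmat]

theorem continuousLinearMap_apply_zero_prod
    (φ : (Fin D → ℝ) × (Fin D → ℝ) →L[ℝ] ℝ) (y : Fin D → ℝ) :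
    φ (0, y) = (fun a => φ (0, Pi.single a 1)) ⬝ᵥ y := by
  exact (LinearMap.congr_fun ((dotProductEquiv ℝ (Fin D)).apply_symm_apply
    (φ.toLinearMap ∘ₗ LinearMap.inr ℝ _ _)) y).symm

theorem continuousLinearMap_apply_prod_zero
    (φ : (Fin D → ℝ) × (Fin D → ℝ) →L[ℝ] ℝ) (y : Fin D → ℝ) :
    φ (y, 0) = (fun a => φ (Pi.single a 1, 0)) ⬝ᵥ y := by
  exact (LinearMap.congr_fun ((dotProductEquiv ℝ (Fin D)).apply_symm_apply
    (φ.toLinearMap ∘ₗ LinearMap.inl ℝ _ _)) y).symm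

/-- The vertical part of `dE` is given by the velocity Hessian. -/
theorem fderiv_energy_vertical (hL : ContDiff ℝ 2 L) (u : (Fin D → ℝ) × (Fin D → ℝ))
    (y : Fin D → ℝ) :
    fderiv ℝ (energy D L) u (0, y) = u.2 ⬝ᵥ hessV D L u *ᵥ y := by
  have hcoord (i : Fin D) : HasFDerivAt (fun x : (Fin D → ℝ) × (Fin D → ℝ) => x.2 i)
      ((ContinuousLinearMap.proj (R := ℝ) (φ := fun _ : Fin D => ℝ) i).comp
        (ContinuousLinearMap.snd ℝ (Fin D → ℝ) (Fin D → ℝ))) u :=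
    ((ContinuousLinearMap.proj (R := ℝ) (φ := fun _ : Fin D => ℝ) i).comp
      (ContinuousLinearMap.snd ℝ (Fin D → ℝ) (Fin D → ℝ))).hasFDerivAt
  have hE : HasFDerivAt (energy D L) _ u :=
    (HasFDerivAt.fun_sum fun i (_ : i ∈ Finset.univ) => (hcoord i).mul
      (differentiable_fderiv_apply hL (0, Pi.single i 1) u).hasFDerivAt).sub
      (hL.differentiable (by norm_num) u).hasFDerivAt
  rw [hE.fderiv]
  have hM (i : Fin D) : (hessV D L u *ᵥ y) i =
      fderiv ℝ (fun w => fderiv ℝ L w (0, Pi.single i 1)) u (0, y) :=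
    (continuousLinearMap_apply_zero_prod _ y).symm
  simp [dotProduct, hM, Finset.sum_add_distrib, 
    continuousLinearMap_apply_zero_prod (fderiv ℝ L u) y]

/-- The energy equation for a second-order vector reduces to a linear equation for the
acceleration. -/
theorem energy_equation_iff (hL : ContDiff ℝ 2 L) (u : (Fin D → ℝ) × (Fin D → ℝ))
    (x : Fin D → ℝ) :
    (∀ Y, Omega D (hessV D L u) (Fmat D L u) (u.2, x) Y = fderiv ℝ (energy D L) u Y) ↔
      hessV D L u *ᵥ x = -(gradQ D (energy D L) u + Fmat D L u *ᵥ u.2) := by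
  have hd (Y : (Fin D → ℝ) × (Fin D → ℝ)) : fderiv ℝ (energy D L) u Y =
      gradQ D (energy D L) u ⬝ᵥ Y.1 + u.2 ⬝ᵥ hessV D L u *ᵥ Y.2 := by
    rw [← fderiv_energy_vertical hL]
    unfold gradQ
    rw [← continuousLinearMap_apply_prod_zero, ← map_add]
    simp
  have hF (y : Fin D → ℝ) : u.2 ⬝ᵥ Fmat D L u *ᵥ y = -((Fmat D L u *ᵥ u.2) ⬝ᵥ y) := by
    rw [dotProduct_mulVec, ← mulVec_transpose, Fmat_transpose, neg_mulVec, neg_dotProduct]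
  simp only [Omega, hd, hF]
  constructor
  · intro h
    refine dotProduct_eq _ _ fun y => ?_
    have hy := h (y, 0)
    simp only [mulVec_zero, dotProduct_zero, dotProduct_comm y] at hy
    rw [neg_dotProduct, add_dotProduct]
    linarith
  · intro h Y
    rw [h, dotProduct_comm Y.1, neg_dotProduct, add_dotProduct]
    ring

end

/-- **Theorem (existence of second-order solutions and first-order constraints).**
There exists a second-order solution `X = (v, Xv)` of the energy equation at `(q,v)`
iff all first-order constraint functions vanish there:
`⟨z, ∇_q E + F·v⟩ = 0` for every `z ∈ ker M(q,v)`. -/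
theorem second_order_solution_iff_constraints (D : ℕ)
    (L : (Fin D → ℝ) × (Fin D → ℝ) → ℝ) (hL : ContDiff ℝ 2 L)
    (u : (Fin D → ℝ) × (Fin D → ℝ)) :
    (∃ Xv : Fin D → ℝ,
      ∀ Y, Omega D (hessV D L u) (Fmat D L u) (u.2, Xv) Y =
        fderiv ℝ (energy D L) u Y) ↔
    (∀ z : Fin D → ℝ, (hessV D L u).mulVec z = 0 →
      z ⬝ᵥ (gradQ D (energy D L) u + (Fmat D L u).mulVec u.2) = 0) := by
  simp only [energy_equation_iff hL]
  constructor
  · rintro ⟨x, hx⟩ z hz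
    rw [← neg_eq_zero, ← dotProduct_neg, ← hx, dotProduct_mulVec, ← mulVec_transpose,
      (hessV_isSymm hL u).eq, hz, zero_dotProduct]
  · intro h
    refine (hessV_isSymm hL u).exists_mulVec_eq_of_forall_dotProduct_eq_zero fun z hz => ?_
    rw [dotProduct_neg, h z hz, neg_zero]
end

section
/- Let L : ℝ^D × ℝ^D → ℝ be twice continuously differentiable, with velocity Hessian M(q,v) and Lagrangian two-form Ω_L(q,v) as defined, and let T be the Fréchet derivative at (q,v) of the fibre derivative FL(q,v) = (q, ∂L/∂v(q,v)). Assume dim(ker Ω_L(q,v)) = 2·dim(ker M(q,v)). Then a linear functional σ on ℝ^D × ℝ^D vanishes on the range of T (σ ∘ T = 0) if and only if there exists K ∈ ker Ω_L(q,v) such that σ(Y) = ω(T K, Y) for all Y, where ω((a,b),(c,d)) = ⟨a,d⟩ − ⟨c,b⟩ is the canonical symplectic bilinear form. (Pointwise form of: a one-form lies in the kernel of the pullback ℒ* if and only if it is a primary-constraint one-form.) -/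
open Matrix

/-- The kernel of `Omega` as a submodule of `ℝ^D × ℝ^D`. -/
def kerOmega (D : ℕ) (M F : Matrix (Fin D) (Fin D) ℝ) :
    Submodule ℝ ((Fin D → ℝ) × (Fin D → ℝ)) where
  carrier := {K | ∀ Y, Omega D M F K Y = 0}
  add_mem' := by
    intro a b ha hb Y
    have h1 := ha Y
    have h2 := hb Y
    simp only [Omega] at h1 h2 ⊢
    simp only [Prod.fst_add, Prod.snd_add, add_dotProduct, Matrix.mulVec_add, dotProduct_add]
    linarith
  zero_mem' := by
    intro Y
    simp [Omega]
  smul_mem' := by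
    intro c a ha Y
    have h := ha Y
    simp only [Omega] at h ⊢
    simp only [Prod.smul_fst, Prod.smul_snd, smul_dotProduct, Matrix.mulVec_smul,
      dotProduct_smul, smul_eq_mul]
    linear_combination c * h

open Module in
/-- If `B` is a bilinear form injective in its first argument and `N` is a subspace whose image
under `T` is `B`-orthogonal to the range of `T`, then `K ↦ B (T K)` maps `N` onto the annihilator
of the range of `T` as soon as `2 dim (ker T) ≤ dim N`. -/
theorem exists_mem_eq_of_vanishes_on_range {V : Type*} [AddCommGroup V] [Module ℝ V]
    [FiniteDimensional ℝ V] (T : V →ₗ[ℝ] V) (B : V →ₗ[ℝ] V →ₗ[ℝ] ℝ)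
    (hB : Function.Injective B) (N : Submodule ℝ V)
    (horth : ∀ K ∈ N, ∀ X, B (T K) (T X) = 0)
    (hN : 2 * finrank ℝ (LinearMap.ker T) ≤ finrank ℝ N) (σ : V →ₗ[ℝ] ℝ)
    (hσ : ∀ X, σ (T X) = 0) : ∃ K ∈ N, σ = B (T K) := by
  let Φ : N →ₗ[ℝ] Dual ℝ V := (B ∘ₗ T) ∘ₗ N.subtype
  have hle : LinearMap.range Φ ≤ (LinearMap.range T).dualAnnihilator := by
    rintro _ ⟨K, rfl⟩
    rw [Submodule.mem_dualAnnihilator]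
    rintro _ ⟨X, rfl⟩
    exact horth K K.2 X
  have hann := Subspace.finrank_add_finrank_dualAnnihilator_eq (LinearMap.range T)
  have hT := LinearMap.finrank_range_add_finrank_ker T
  have hΦ := LinearMap.finrank_range_add_finrank_ker Φ
  have hker : finrank ℝ (LinearMap.ker Φ) ≤ finrank ℝ (LinearMap.ker T) := by
    have hmem : ∀ K ∈ LinearMap.ker Φ, N.subtype K ∈ LinearMap.ker T := fun K hK =>
      hB ((show B (T K) = 0 from hK).trans (map_zero B).symm)
    exact LinearMap.finrank_le_finrank_of_injective (f := N.subtype.restrict hmem)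
      fun K K' h => Subtype.ext (Subtype.ext (by simpa using congrArg Subtype.val h))
  have heq := Submodule.eq_of_le_of_finrank_le hle (by omega)
  have hmem : σ ∈ LinearMap.range Φ := by
    rw [heq, Submodule.mem_dualAnnihilator]
    rintro _ ⟨X, rfl⟩
    exact hσ X
  obtain ⟨K, hK⟩ := hmem
  exact ⟨K, K.2, hK.symm⟩

/-- The canonical symplectic pairing as a bilinear map. -/
noncomputable def omegaCanBilin (D : ℕ) :
    ((Fin D → ℝ) × (Fin D → ℝ)) →ₗ[ℝ] ((Fin D → ℝ) × (Fin D → ℝ)) →ₗ[ℝ] ℝ :=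
  LinearMap.mk₂ ℝ (omegaCan D)
    (by intros; simp [omegaCan]; ring) (by intros; simp [omegaCan]; ring)
    (by intros; simp [omegaCan]; ring) (by intros; simp [omegaCan]; ring)

theorem omegaCanBilin_apply (D : ℕ) (X Y : (Fin D → ℝ) × (Fin D → ℝ)) :
    omegaCanBilin D X Y = omegaCan D X Y := rfl

theorem omegaCanBilin_injective (D : ℕ) : Function.Injective (omegaCanBilin D) := by
  rw [injective_iff_map_eq_zero]
  intro X hX
  have h : ∀ Y, omegaCan D X Y = 0 := fun Y => by rw [← omegaCanBilin_apply, hX]; rfl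
  refine Prod.ext (funext fun a => ?_) (funext fun a => ?_)
  · simpa [omegaCan] using h (0, Pi.single a 1)
  · simpa [omegaCan] using h (Pi.single a 1, 0)

/-- The mixed second derivatives `∂²L/∂v^a∂q^b`. -/
noncomputable def hessMixed (D : ℕ) (L : (Fin D → ℝ) × (Fin D → ℝ) → ℝ)
    (u : (Fin D → ℝ) × (Fin D → ℝ)) : Matrix (Fin D) (Fin D) ℝ :=
  Matrix.of fun a b =>
    fderiv ℝ (fun w => fderiv ℝ L w (0, Pi.single a 1)) u (Pi.single b 1, 0)

theorem Fmat_eq_hessMixed_sub_transpose (D : ℕ) (L : (Fin D → ℝ) × (Fin D → ℝ) → ℝ)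
    (u : (Fin D → ℝ) × (Fin D → ℝ)) :
    Fmat D L u = hessMixed D L u - (hessMixed D L u)ᵀ := rfl

theorem clm_prod_apply_eq_sum {D : ℕ} (f : ((Fin D → ℝ) × (Fin D → ℝ)) →L[ℝ] ℝ)
    (X : (Fin D → ℝ) × (Fin D → ℝ)) :
    f X = ∑ b, f (Pi.single b 1, 0) * X.1 b + ∑ b, f (0, Pi.single b 1) * X.2 b := by
  have h1 := LinearMap.pi_apply_eq_sum_univ
    ((f : _ →ₗ[ℝ] ℝ) ∘ₗ LinearMap.inl ℝ (Fin D → ℝ) (Fin D → ℝ)) X.1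
  have h2 := LinearMap.pi_apply_eq_sum_univ
    ((f : _ →ₗ[ℝ] ℝ) ∘ₗ LinearMap.inr ℝ (Fin D → ℝ) (Fin D → ℝ)) X.2
  have hX : f X = f (X.1, 0) + f (0, X.2) := by rw [← map_add]; simp
  have hs : ∀ i : Fin D, (fun j => if i = j then (1 : ℝ) else 0) = Pi.single i 1 := fun i => by
    ext j; simp [Pi.single_apply, eq_comm]
  simp only [LinearMap.comp_apply, LinearMap.inl_apply, LinearMap.inr_apply,
    ContinuousLinearMap.coe_coe, hs, smul_eq_mul] at h1 h2
  rw [hX, h1, h2]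
  simp only [mul_comm]

theorem ContDiff.differentiable_fderiv_of_two {E : Type*} [NormedAddCommGroup E] [NormedSpace ℝ E]
    {L : E → ℝ} (hL : ContDiff ℝ 2 L) : Differentiable ℝ (fderiv ℝ L) :=
  (hL.fderiv_right (m := 1) (by norm_num)).differentiable (by norm_num)

theorem fderiv_FL_apply {D : ℕ} {L : (Fin D → ℝ) × (Fin D → ℝ) → ℝ} (hL : ContDiff ℝ 2 L)
    (u X : (Fin D → ℝ) × (Fin D → ℝ)) :
    fderiv ℝ (FL D L) u X = (X.1, hessMixed D L u *ᵥ X.1 + hessV D L u *ᵥ X.2) := by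
  have hd : ∀ a : Fin D, DifferentiableAt ℝ
      (fun w => fderiv ℝ L w ((0 : Fin D → ℝ), Pi.single a (1 : ℝ))) u := fun a =>
    (ContDiff.differentiable_fderiv_of_two hL u).clm_apply (differentiableAt_const _)
  have h : HasFDerivAt (FL D L) _ u :=
    hasFDerivAt_fst.prodMk (hasFDerivAt_pi.2 fun a => (hd a).hasFDerivAt)
  rw [h.fderiv]
  refine Prod.ext rfl (funext fun a => ?_)
  simpa [Matrix.mulVec, dotProduct, hessMixed, hessV] using
    clm_prod_apply_eq_sum (fderiv ℝ (fun w => fderiv ℝ L w (0, Pi.single a 1)) u) X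

/-- The fibre derivative pulls the canonical symplectic form back to the Lagrangian two-form. -/
theorem omegaCan_fderiv_FL {D : ℕ} {L : (Fin D → ℝ) × (Fin D → ℝ) → ℝ} (hL : ContDiff ℝ 2 L)
    (u X Y : (Fin D → ℝ) × (Fin D → ℝ)) :
    omegaCan D (fderiv ℝ (FL D L) u X) (fderiv ℝ (FL D L) u Y) =
      Omega D (hessV D L u) (Fmat D L u) X Y := by
  have h : X.1 ⬝ᵥ (hessMixed D L u)ᵀ *ᵥ Y.1 = Y.1 ⬝ᵥ hessMixed D L u *ᵥ X.1 := by
    rw [Matrix.mulVec_transpose, dotProduct_comm, Matrix.dotProduct_mulVec]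
  simp only [fderiv_FL_apply hL, omegaCan, Omega, Fmat_eq_hessMixed_sub_transpose,
    Matrix.sub_mulVec, dotProduct_add, dotProduct_sub, h]
  ring

theorem finrank_ker_fderiv_FL_le {D : ℕ} {L : (Fin D → ℝ) × (Fin D → ℝ) → ℝ}
    (hL : ContDiff ℝ 2 L) (u : (Fin D → ℝ) × (Fin D → ℝ)) :
    Module.finrank ℝ (LinearMap.ker (fderiv ℝ (FL D L) u).toLinearMap) ≤
      Module.finrank ℝ (LinearMap.ker (hessV D L u).mulVecLin) := by
  have key : ∀ X ∈ LinearMap.ker (fderiv ℝ (FL D L) u).toLinearMap,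
      X.1 = 0 ∧ hessV D L u *ᵥ X.2 = 0 := fun X hX => by
    have h : fderiv ℝ (FL D L) u X = 0 := hX
    rw [fderiv_FL_apply hL, Prod.mk_eq_zero] at h
    obtain ⟨h1, h2⟩ := h
    exact ⟨h1, by simpa [h1] using h2⟩
  refine LinearMap.finrank_le_finrank_of_injective
    (f := (LinearMap.snd ℝ (Fin D → ℝ) (Fin D → ℝ)).restrict fun X hX => (key X hX).2) ?_
  intro X Y hXY
  refine Subtype.ext (Prod.ext ?_ (congrArg Subtype.val hXY))
  rw [(key X X.2).1, (key Y Y.2).1]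

/-- **Theorem (primary-constraint one-forms = kernel of the pullback `ℒ*`,
pointwise form).**  Assume `dim(ker Ω_L(q,v)) = 2·dim(ker M(q,v))`.  A linear
functional `σ` on `ℝ^D × ℝ^D` vanishes on the range of `T = d(FL)(q,v)` iff
`σ = ω(T K, ·)` for some `K ∈ ker Ω_L(q,v)`. -/
theorem ker_pullback_iff_primary (D : ℕ)
    (L : (Fin D → ℝ) × (Fin D → ℝ) → ℝ) (hL : ContDiff ℝ 2 L)
    (u : (Fin D → ℝ) × (Fin D → ℝ))
    (hdim : Module.finrank ℝ (kerOmega D (hessV D L u) (Fmat D L u)) =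
      2 * Module.finrank ℝ (LinearMap.ker (hessV D L u).mulVecLin))
    (σ : ((Fin D → ℝ) × (Fin D → ℝ)) →ₗ[ℝ] ℝ) :
    (∀ X, σ (fderiv ℝ (FL D L) u X) = 0) ↔
      ∃ K ∈ kerOmega D (hessV D L u) (Fmat D L u),
        ∀ Y, σ Y = omegaCan D (fderiv ℝ (FL D L) u K) Y := by
  constructor
  · intro hσ
    obtain ⟨K, hK, h⟩ := exists_mem_eq_of_vanishes_on_range
      (fderiv ℝ (FL D L) u).toLinearMap (omegaCanBilin D) (omegaCanBilin_injective D)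
      (kerOmega D (hessV D L u) (Fmat D L u))
      (fun K hK X => (omegaCan_fderiv_FL hL u K X).trans (hK X))
      (hdim ▸ Nat.mul_le_mul_left 2 (finrank_ker_fderiv_FL_le hL u)) σ hσ
    exact ⟨K, hK, fun Y => by rw [h]; rfl⟩
  · rintro ⟨K, hK, h⟩ X
    rw [h, omegaCan_fderiv_FL hL]
    exact hK X
end

section
/- Let L : ℝ^D × ℝ^D → ℝ be twice continuously differentiable, with velocity Hessian M(q,v), antisymmetric matrix F(q,v), energy E, Lagrangian two-form Ω_L(q,v) as defined, and let T be the Fréchet derivative at (q,v) of the fibre derivative FL(q,v) = (q, ∂L/∂v(q,v)). Then: (i) for any K, K' ∈ ker Ω_L(q,v), ω(T K, T K') = 0; and (ii) if X solves the energy equation at (q,v) (Ω_L(q,v)(X,Y) = dE(q,v)(Y) for all Y), then for any K ∈ ker Ω_L(q,v), ω(T K, T X) = −dE(q,v)(K) = −⟨Kq, ∇_q E(q,v) + F(q,v)·v⟩. (This is the pointwise identity ⟨π_{(n)}|𝔓_{(m)}⟩ = 0 and ⟨π_{(n)}|𝔛_C⟩ = −γ_n^{[1]} underlying the equivalence of the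 Lagrangian constraint algorithm with Hamiltonian stability analysis.) -/
open Matrix

theorem ContinuousLinearMap.apply_prod_eq_dotProduct {D : ℕ}
    (A : (Fin D → ℝ) × (Fin D → ℝ) →L[ℝ] ℝ) (x : (Fin D → ℝ) × (Fin D → ℝ)) :
    A x = (x.1 ⬝ᵥ fun b => A (Pi.single b 1, 0)) + x.2 ⬝ᵥ fun b => A (0, Pi.single b 1) := by
  have h (B : (Fin D → ℝ) →L[ℝ] ℝ) (y : Fin D → ℝ) : B y = y ⬝ᵥ fun b => B (Pi.single b 1) := by
    conv_lhs => rw [pi_eq_sum_univ' y, map_sum]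
    simp [dotProduct]
  have h₁ := h (A.comp (.inl ℝ _ _)) x.1
  have h₂ := h (A.comp (.inr ℝ _ _)) x.2
  simp only [ContinuousLinearMap.comp_apply, ContinuousLinearMap.inl_apply,
    ContinuousLinearMap.inr_apply] at h₁ h₂
  rw [← h₁, ← h₂, ← map_add]
  simp

/-- The mixed Hessian `∂²L/∂v^a∂q^b`. -/
noncomputable def hessVQ (D : ℕ) (L : (Fin D → ℝ) × (Fin D → ℝ) → ℝ)
    (u : (Fin D → ℝ) × (Fin D → ℝ)) : Matrix (Fin D) (Fin D) ℝ :=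
  Matrix.of fun a b =>
    fderiv ℝ (fun w => fderiv ℝ L w (0, Pi.single a 1)) u (Pi.single b 1, 0)

theorem Fmat_eq_sub_transpose (D : ℕ) (L : (Fin D → ℝ) × (Fin D → ℝ) → ℝ)
    (u : (Fin D → ℝ) × (Fin D → ℝ)) : Fmat D L u = hessVQ D L u - (hessVQ D L u)ᵀ := rfl

theorem differentiable_gradV {D : ℕ} {L : (Fin D → ℝ) × (Fin D → ℝ) → ℝ}
    (hL : ContDiff ℝ 2 L) : Differentiable ℝ (gradV D L) := by
  have h : Differentiable ℝ (fderiv ℝ L) :=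
    (hL.fderiv_right (m := 1) (by norm_num)).differentiable (by norm_num)
  exact differentiable_pi.2 fun a => h.clm_apply (differentiable_const _)

theorem fderiv_gradV {D : ℕ} {L : (Fin D → ℝ) × (Fin D → ℝ) → ℝ}
    (hL : ContDiff ℝ 2 L) (u X : (Fin D → ℝ) × (Fin D → ℝ)) :
    fderiv ℝ (gradV D L) u X = hessVQ D L u *ᵥ X.1 + hessV D L u *ᵥ X.2 := by
  ext a
  have h := (hasFDerivAt_pi'.1 (differentiable_gradV hL u).hasFDerivAt a).fderiv
  have h' := DFunLike.congr_fun h X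
  simp only [ContinuousLinearMap.comp_apply, ContinuousLinearMap.proj_apply] at h'
  rw [← h', ContinuousLinearMap.apply_prod_eq_dotProduct, dotProduct_comm X.1, dotProduct_comm X.2]
  rfl

theorem fderiv_FL {D : ℕ} {L : (Fin D → ℝ) × (Fin D → ℝ) → ℝ}
    (hL : ContDiff ℝ 2 L) (u X : (Fin D → ℝ) × (Fin D → ℝ)) :
    fderiv ℝ (FL D L) u X = (X.1, hessVQ D L u *ᵥ X.1 + hessV D L u *ᵥ X.2) := by
  have h : HasFDerivAt (FL D L) ((ContinuousLinearMap.fst ℝ _ _).prod (fderiv ℝ (gradV D L) u)) u :=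
    hasFDerivAt_fst.prodMk (differentiable_gradV hL u).hasFDerivAt
  rw [h.fderiv, ContinuousLinearMap.prod_apply, fderiv_gradV hL]
  rfl

theorem omegaCan_swap {D : ℕ} (X Y : (Fin D → ℝ) × (Fin D → ℝ)) :
    omegaCan D X Y = -omegaCan D Y X := by
  simp [omegaCan]

theorem fderiv_energy {D : ℕ} {L : (Fin D → ℝ) × (Fin D → ℝ) → ℝ}
    (hL : ContDiff ℝ 2 L) (u X : (Fin D → ℝ) × (Fin D → ℝ)) :
    fderiv ℝ (energy D L) u X =
      X.1 ⬝ᵥ gradQ D (energy D L) u + u.2 ⬝ᵥ hessV D L u *ᵥ X.2 := by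
  have hv (a : Fin D) : HasFDerivAt (fun w : (Fin D → ℝ) × (Fin D → ℝ) => w.2 a)
      ((ContinuousLinearMap.proj a).comp (ContinuousLinearMap.snd ℝ _ _)) u :=
    hasFDerivAt_pi'.1 hasFDerivAt_snd a
  have hg := hasFDerivAt_pi'.1 (differentiable_gradV hL u).hasFDerivAt
  have hE := (HasFDerivAt.fun_sum (u := Finset.univ) fun a _ => (hv a).mul (hg a)).sub
    (hL.differentiable (by norm_num) u).hasFDerivAt
  have hd (Y : (Fin D → ℝ) × (Fin D → ℝ)) : fderiv ℝ (energy D L) u Y =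
      u.2 ⬝ᵥ fderiv ℝ (gradV D L) u Y + Y.2 ⬝ᵥ gradV D L u - fderiv ℝ L u Y := by
    have h' : HasFDerivAt (energy D L) _ u := hE
    rw [h'.fderiv]
    simp [dotProduct, Finset.sum_add_distrib, mul_comm]
  have hsplit : fderiv ℝ (energy D L) u X =
      fderiv ℝ (energy D L) u (X.1, 0) + fderiv ℝ (energy D L) u (0, X.2) := by
    rw [← map_add]
    simp
  have hq : fderiv ℝ (energy D L) u (X.1, 0) = X.1 ⬝ᵥ gradQ D (energy D L) u := by
    rw [ContinuousLinearMap.apply_prod_eq_dotProduct, zero_dotProduct, add_zero]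
    rfl
  have hL' : fderiv ℝ L u (0, X.2) = X.2 ⬝ᵥ gradV D L u := by
    rw [ContinuousLinearMap.apply_prod_eq_dotProduct, zero_dotProduct, zero_add]
    rfl
  rw [hsplit, hq, hd, hL', fderiv_gradV hL]
  simp

/-- **Theorem (pointwise identities underlying the equivalence of the Lagrangian
constraint algorithm with the Hamiltonian stability analysis).**
With `T = d(FL)(q,v)`: (i) `ω(T K, T K') = 0` for `K, K' ∈ ker Ω_L(q,v)`, and
(ii) if `X` solves the energy equation then, for `K ∈ ker Ω_L(q,v)`,
`ω(T K, T X) = −dE(q,v)(K) = −⟨Kq, ∇_q E + F·v⟩`. -/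
theorem primary_pairing_identities (D : ℕ)
    (L : (Fin D → ℝ) × (Fin D → ℝ) → ℝ) (hL : ContDiff ℝ 2 L)
    (u : (Fin D → ℝ) × (Fin D → ℝ)) :
    (∀ K K' : (Fin D → ℝ) × (Fin D → ℝ),
      (∀ Y, Omega D (hessV D L u) (Fmat D L u) K Y = 0) →
      (∀ Y, Omega D (hessV D L u) (Fmat D L u) K' Y = 0) →
      omegaCan D (fderiv ℝ (FL D L) u K) (fderiv ℝ (FL D L) u K') = 0) ∧
    (∀ X K : (Fin D → ℝ) × (Fin D → ℝ),
      (∀ Y, Omega D (hessV D L u) (Fmat D L u) X Y = fderiv ℝ (energy D L) u Y) →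
      (∀ Y, Omega D (hessV D L u) (Fmat D L u) K Y = 0) →
      omegaCan D (fderiv ℝ (FL D L) u K) (fderiv ℝ (FL D L) u X) =
          -fderiv ℝ (energy D L) u K ∧
        omegaCan D (fderiv ℝ (FL D L) u K) (fderiv ℝ (FL D L) u X) =
          -(K.1 ⬝ᵥ (gradQ D (energy D L) u + (Fmat D L u).mulVec u.2))) := by
  refine ⟨fun K K' hK _ => by rw [omegaCan_fderiv_FL hL, hK], fun X K hX hK => ?_⟩
  have h : omegaCan D (fderiv ℝ (FL D L) u K) (fderiv ℝ (FL D L) u X) =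
      -fderiv ℝ (energy D L) u K := by
    rw [omegaCan_swap, omegaCan_fderiv_FL hL, hX]
  have hF : K.1 ⬝ᵥ Fmat D L u *ᵥ u.2 = u.2 ⬝ᵥ hessV D L u *ᵥ K.2 := by
    simpa [Omega, sub_eq_zero] using hK (u.2, 0)
  exact ⟨h, by rw [h, fderiv_energy hL, dotProduct_add, hF]⟩
end
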